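/- arXiv:0910.0452 — 2 statements merged into one kernel-verified Lean document; each statement's English description precedes it below -/
import Mathlib

section
/- For all real numbers a, b, c, d > 0 satisfying c + d > 1, c ≤ 1, d ≤ 1, we have 0 < (1 + ad + bc)/(a + b + c + d + ab) < 1. Moreover the ratio can be made arbitrarily close to 0 (e.g. a = b = n, c = d = 1, n → ∞) and arbitrarily close to 1 (e.g. a = n, b = 1/n, c = d = 1, n → ∞). -/
open scoped BigOperators

/-- The wedge product of two plane vectors: half the cross product,
the signed area of the triangle spanned by them. -/
noncomputable def wedge (v u : ℝ × ℝ) : ℝ := (v.1 * u.2 - v.2 * u.1) / 2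

/-- Signed (shoelace) area of a polygon given by its vertices. -/
noncomputable def polyArea {n : ℕ} [NeZero n] (A : Fin n → ℝ × ℝ) : ℝ :=
  ∑ i : Fin n, wedge (A i) (A (i + 1))

/-- Signed area of a triangle. -/
noncomputable def triArea (X Y Z : ℝ × ℝ) : ℝ := wedge (Y - X) (Z - X)

/-- `A` lists the vertices of a convex polygon in counterclockwise order:
all other vertices lie strictly to the left of each directed edge. -/
def IsConvexCCW {n : ℕ} [NeZero n] (A : Fin n → ℝ × ℝ) : Prop :=
  ∀ i j : Fin n, j ≠ i → j ≠ i + 1 → 0 < wedge (A (i + 1) - A i) (A j - A i)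

/-- The first m-Kasner descendant: each vertex divides a side in ratio m:(1-m). -/
noncomputable def kasner {n : ℕ} [NeZero n] (m : ℝ) (A : Fin n → ℝ × ℝ) :
    Fin n → ℝ × ℝ :=
  fun i => A i + m • (A (i + 1) - A i)

theorem pentagon_ratio_algebra :
    (∀ a b c d : ℝ, 0 < a → 0 < b → 0 < c → 0 < d →
      1 < c + d → c ≤ 1 → d ≤ 1 →
      0 < (1 + a * d + b * c) / (a + b + c + d + a * b) ∧
      (1 + a * d + b * c) / (a + b + c + d + a * b) < 1) ∧
    Filter.Tendsto (fun n : ℝ =>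
        (1 + n * 1 + n * 1) / (n + n + 1 + 1 + n * n)) Filter.atTop (nhds 0) ∧
    Filter.Tendsto (fun n : ℝ =>
        (1 + n * 1 + (1 / n) * 1) / (n + 1 / n + 1 + 1 + n * (1 / n)))
      Filter.atTop (nhds 1) := by
  refine ⟨fun a b c d ha hb hc hd hcd hc1 hd1 => ?_, ?_, ?_⟩
  · have hden : 0 < a + b + c + d + a * b := by positivity
    refine ⟨by positivity, ?_⟩
    rw [div_lt_one hden]
    have had : a * d ≤ a := mul_le_of_le_one_right ha.le hd1
    have hbc : b * c ≤ b := mul_le_of_le_one_right hb.le hc1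
    linarith [mul_pos ha hb]
  · have hlim : Filter.Tendsto (fun n : ℝ => 2 / n) Filter.atTop (nhds 0) :=
      Filter.Tendsto.const_div_atTop Filter.tendsto_id 2
    refine tendsto_of_tendsto_of_tendsto_of_le_of_le' tendsto_const_nhds hlim ?_ ?_
    · filter_upwards [Filter.eventually_gt_atTop 0] with n hn
      positivity
    · filter_upwards [Filter.eventually_gt_atTop 0] with n hn
      rw [div_le_div_iff₀ (by positivity) hn]
      nlinarith
  · have hlim : Filter.Tendsto (fun n : ℝ => 1 - 2 / n) Filter.atTop (nhds 1) := by
      simpa using (Filter.Tendsto.const_div_atTop Filter.tendsto_id (2 : ℝ)).const_sub (1 : ℝ)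
    refine tendsto_of_tendsto_of_tendsto_of_le_of_le' hlim tendsto_const_nhds ?_ ?_
    · filter_upwards [Filter.eventually_gt_atTop 0] with n hn
      have hinv : 0 < 1 / n := by positivity
      have hden : 0 < n + 1 / n + 1 + 1 + n * (1 / n) := by positivity
      have hmul : n * (1 / n) = 1 := mul_one_div_cancel hn.ne'
      have hsub : (1 + n * 1 + (1 / n) * 1) / (n + 1 / n + 1 + 1 + n * (1 / n)) =
          1 - 2 / (n + 1 / n + 1 + 1 + n * (1 / n)) := by
        rw [eq_sub_iff_add_eq, ← add_div, div_eq_one_iff_eq hden.ne']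
        linarith
      rw [hsub]
      gcongr
      linarith
    · filter_upwards [Filter.eventually_gt_atTop 0] with n hn
      have hmul : n * (1 / n) = 1 := mul_one_div_cancel hn.ne'
      rw [div_le_one (by positivity)]
      linarith
end

section
/- Let m ∈ (0,1) and let K = A₁…A_{n+1} be a positively oriented convex (n+1)-gon, n ≥ 6, with first m-Kasner descendant K'. Then there is a vertex whose removal yields a convex n-gon L such that Δ(K')/Δ(K) ≥ Δ(L')/Δ(L), where L' is the first m-Kasner descendant of L. -/
open scoped BigOperators

theorem wedge_swap (u v : ℝ × ℝ) : wedge u v = -wedge v u := by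
  simp only [wedge]; ring

theorem wedge_self (u : ℝ × ℝ) : wedge u u = 0 := by
  simp only [wedge]; ring

theorem wedge_pluecker (u v x y : ℝ × ℝ) :
    wedge u v * wedge x y = wedge u x * wedge v y - wedge u y * wedge v x := by
  simp only [wedge]; ring

/-- Within an open half plane, the order by angle is transitive. -/
theorem wedge_pos_trans {u x y z : ℝ × ℝ} (hy : 0 < wedge u y)
    (hx : 0 ≤ wedge u x) (hz : 0 < wedge u z) (hxy : 0 < wedge x y) (hyz : 0 < wedge y z) :
    0 < wedge x z := by
  have h := wedge_pluecker u y x z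
  rw [wedge_swap y x] at h
  have h₁ := mul_nonneg hx hyz.le
  have h₂ := mul_pos hz hxy
  exact pos_of_mul_pos_right (by nlinarith : 0 < wedge u y * wedge x z) hy.le

section Sequence

/-- The edge vector of the closed polygon `B` starting at the vertex `B k`. -/
def edge (B : ℤ → ℝ × ℝ) (k : ℤ) : ℝ × ℝ := B (k + 1) - B k

/-- `B` lists periodically the vertices of a convex `N`-gon. -/
structure ConvexSeq (N : ℤ) (B : ℤ → ℝ × ℝ) : Prop where
  periodic : ∀ k, B (k + N) = B k
  pos : ∀ a j, a + 1 < j → j < a + N → 0 < wedge (B (a + 1) - B a) (B j - B a)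

variable {N : ℤ} {B : ℤ → ℝ × ℝ}

theorem ConvexSeq.wedge_edge_succ_pos (h : ConvexSeq N B) (hN : 3 ≤ N) (k : ℤ) :
    0 < wedge (edge B k) (edge B (k + 1)) := by
  have := h.pos k (k + 1 + 1) (by omega) (by omega)
  simp only [wedge, edge, Prod.fst_sub, Prod.snd_sub] at this ⊢
  linarith

theorem ConvexSeq.edge_add (h : ConvexSeq N B) (k : ℤ) : edge B (k + N) = edge B k := by
  simp only [edge, h.periodic]
  rw [show k + N + 1 = k + 1 + N by ring, h.periodic]

theorem ConvexSeq.wedge_edge_neg_succ (h : ConvexSeq N B) (hN : 3 ≤ N) {a b : ℤ} (hab : a < b)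
    (hb : b + 1 < a + N) (hE : wedge (edge B a) (edge B b) ≤ 0) :
    wedge (edge B a) (edge B (b + 1)) < 0 := by
  by_contra! hc
  have h₁ := h.pos a (b + 1) (by omega) (by omega)
  have h₂ := h.pos b (a + N) (by omega) (by omega)
  have h₃ : 0 ≤ wedge (edge B (b + 1)) (B a - B (b + 1)) := by
    rcases (show b + 1 + 1 < a + N ∨ b + 1 + 1 = a + N by omega) with h' | h'
    · have := h.pos (b + 1) (a + N) (by omega) (by omega)
      rw [h.periodic] at this
      exact this.le
    · rw [edge, h', h.periodic, wedge_self]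
  rw [h.periodic] at h₂
  have h₄ := h.wedge_edge_succ_pos hN b
  have hu : wedge (edge B a) (B a - B (b + 1)) < 0 := by
    simp only [wedge, edge, Prod.fst_sub, Prod.snd_sub] at h₁ ⊢
    linarith
  have hx : 0 ≤ wedge (edge B b) (B a - B (b + 1)) := by
    simp only [wedge, edge, Prod.fst_sub, Prod.snd_sub] at h₂ ⊢
    linarith
  have key := wedge_pluecker (edge B a) (B a - B (b + 1)) (edge B b) (edge B (b + 1))
  rw [wedge_swap (B a - B (b + 1)) (edge B (b + 1)),
    wedge_swap (B a - B (b + 1)) (edge B b)] at key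
  have k₁ := mul_neg_of_neg_of_pos hu h₄
  have k₂ := mul_nonneg hc hx
  have k₃ := mul_nonneg (neg_nonneg.2 hE) h₃
  linarith

theorem ConvexSeq.wedge_edge_neg_of_le (h : ConvexSeq N B) (hN : 3 ≤ N) {a b c : ℤ} (hab : a < b)
    (hE : wedge (edge B a) (edge B b) < 0) (hbc : b ≤ c) :
    c < a + N → wedge (edge B a) (edge B c) < 0 := by
  induction c, hbc using Int.leInduction with
  | base => exact fun _ => hE
  | succ c hbc ih =>
    exact fun hc => h.wedge_edge_neg_succ hN (by omega) hc (ih (by omega)).le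

/-- At most one of two disjoint boundary arcs of a convex polygon turns by more than `π`. -/
theorem ConvexSeq.wedge_edge_nonneg_of_neg (h : ConvexSeq N B) (hN : 3 ≤ N) {a b c d : ℤ}
    (hE : wedge (edge B a) (edge B b) < 0) (hab : a < b) (hbc : b ≤ c) (hcd : c < d)
    (hd : d ≤ a + N) : 0 ≤ wedge (edge B c) (edge B d) := by
  have neg := fun x hx => h.wedge_edge_neg_of_le (c := x) hN hab hE hx
  rcases hd.lt_or_eq with hd | rfl
  · have hcd' : c ≤ d := hcd.le
    clear hcd
    induction d, hcd' using Int.leInduction with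
    | base => rw [wedge_self]
    | succ d hcd ih =>
      have ih := ih (by omega) (by omega)
      have h₁ := neg c (by omega) (by omega)
      have h₂ := neg d (by omega) (by omega)
      have h₃ := neg (d + 1) (by omega) (by omega)
      have h₄ := h.wedge_edge_succ_pos hN d
      have key := wedge_pluecker (edge B a) (edge B d) (edge B c) (edge B (d + 1))
      rw [wedge_swap (edge B d) (edge B c)] at key
      have k₁ := mul_neg_of_neg_of_pos h₁ h₄
      have k₂ := mul_nonpos_of_nonpos_of_nonneg h₃.le ih
      by_contra! hc
      have k₃ := mul_pos_of_neg_of_neg h₂ hc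
      linarith
  · rw [h.edge_add, wedge_swap]
    linarith [neg c hbc (by omega)]

theorem ConvexSeq.exists_arcs_nonneg (h : ConvexSeq N B) (hN : 7 ≤ N) :
    ∃ k, 0 ≤ wedge (edge B (k - 3)) (edge B (k - 1)) ∧
      0 ≤ wedge (edge B (k - 2)) (edge B (k + 1)) ∧
      0 ≤ wedge (edge B k) (edge B (k + 2)) := by
  have R := fun {a b c d : ℤ} => h.wedge_edge_nonneg_of_neg (a := a) (b := b) (c := c) (d := d)
    (by omega)
  by_cases h₁ : wedge (edge B (-3)) (edge B (-1)) < 0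
  · exact ⟨2, by norm_num; refine ⟨?_, ?_, ?_⟩ <;> refine R h₁ ?_ ?_ ?_ ?_ <;> omega⟩
  by_cases h₂ : wedge (edge B 0) (edge B 2) < 0
  · exact ⟨5, by norm_num; refine ⟨?_, ?_, ?_⟩ <;> refine R h₂ ?_ ?_ ?_ ?_ <;> omega⟩
  by_cases h₃ : wedge (edge B (-2)) (edge B 1) < 0
  · by_cases h₄ : wedge (edge B 4) (edge B 6) < 0
    · exact ⟨9, by norm_num; refine ⟨?_, ?_, ?_⟩ <;> refine R h₄ ?_ ?_ ?_ ?_ <;> omega⟩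
    · refine ⟨4, ?_, ?_, by norm_num; linarith⟩ <;> norm_num <;> refine R h₃ ?_ ?_ ?_ ?_ <;> omega
  · exact ⟨0, by norm_num; refine ⟨?_, ?_, ?_⟩ <;> linarith⟩

theorem ConvexSeq.exists_wedge_edge_le (h : ConvexSeq N B) (hN : 7 ≤ N) :
    ∃ k, wedge (edge B (k - 1)) (edge B k) ≤
      wedge (edge B (k - 2)) (edge B k) + wedge (edge B (k - 1)) (edge B (k + 1)) := by
  by_contra! H
  obtain ⟨k, h₁, h₂, h₃⟩ := h.exists_arcs_nonneg hN
  have H₁ := H (k - 1)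
  have H₂ := H (k + 1)
  have t₁ := h.wedge_edge_succ_pos (by omega) (k - 2)
  have t₂ := h.wedge_edge_succ_pos (by omega) (k - 1)
  have t₃ := h.wedge_edge_succ_pos (by omega) k
  have key := wedge_pluecker (edge B (k - 2)) (edge B k) (edge B (k - 1)) (edge B (k + 1))
  rw [wedge_swap (edge B k) (edge B (k - 1))] at key
  have U := h.wedge_edge_neg_succ (a := k - 2) (b := k) (by omega) (by omega) (by omega)
  ring_nf at H₁ H₂ t₁ t₂ t₃ key h₁ h₂ h₃ U
  generalize wedge (edge B (-2 + k)) (edge B k) = w at *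
  generalize wedge (edge B (-1 + k)) (edge B (1 + k)) = w' at *
  have k₀ : 0 < w := by
    by_contra! hw
    linarith [U hw]
  have k₁ := mul_nonneg t₂.le h₂
  have k₂ := mul_pos t₁ t₃
  have k₃ : 0 < w' := pos_of_mul_pos_right (by linarith : 0 < w * w') k₀.le
  have k₄ : w < wedge (edge B (-2 + k)) (edge B (-1 + k)) := by linarith
  have k₅ : w' < wedge (edge B k) (edge B (1 + k)) := by linarith
  have k₆ := mul_lt_mul'' k₄ k₅ k₀.le k₃.le
  linarith

/-- Every three vertices of a convex polygon, in cyclic order, form a positive triangle. -/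
theorem ConvexSeq.tri_pos (h : ConvexSeq N B) {a b c : ℤ} (hab : a < b) (hbc : b < c)
    (hc : c < a + N) : 0 < wedge (B b - B a) (B c - B a) := by
  have h₁ : ∀ j, a + 1 < j → j < a + N → 0 < wedge (B (a + 1) - B a) (B j - B a) := h.pos a
  have h₂ : ∀ j, a < j → j + 1 < a + N → 0 < wedge (B j - B a) (B (j + 1) - B a) := by
    intro j hj hj'
    have := h.pos j (a + N) (by omega) (by omega)
    rw [h.periodic] at this
    simp only [wedge, Prod.fst_sub, Prod.snd_sub] at this ⊢
    linarith
  have hbc' : b + 1 ≤ c := hbc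
  clear hbc
  induction c, hbc' using Int.leInduction with
  | base => exact h₂ b hab hc
  | succ c hbc ih =>
    refine wedge_pos_trans (h₁ c (by omega) (by omega)) ?_ (h₁ _ (by omega) hc)
      (ih (by omega)) (h₂ c (by omega) hc)
    rcases (show a + 1 = b ∨ a + 1 < b by omega) with rfl | h'
    · rw [wedge_self]
    · exact (h₁ b h' (by omega)).le

end Sequence

section Cyclic

variable {M : ℕ} [NeZero M] {α : Type*}

/-- The periodic extension to `ℤ` of a sequence indexed by `Fin M`. -/
def cyc (G : Fin M → α) (k : ℤ) : α := G (Fin.ofNat M (k % M).toNat)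

theorem cyc_add (G : Fin M → α) (k : ℤ) : cyc G (k + M) = cyc G k := by
  simp [cyc]

theorem cyc_emod (G : Fin M → α) (k c : ℤ) : cyc G (k % M + c) = cyc G (k + c) := by
  simp [cyc]

theorem cyc_of_lt (G : Fin M → α) {k : ℕ} (hk : k < M) : cyc G k = G ⟨k, hk⟩ := by
  have : ((k : ℤ) % M).toNat = k := by
    rw [Int.emod_eq_of_lt (by omega) (by omega)]; simp
  simp only [cyc, this]
  congr 1
  exact Fin.ext (Nat.mod_eq_of_lt hk)

theorem cyc_val (G : Fin M → α) (i : Fin M) : cyc G (i : ℕ) = G i := cyc_of_lt G i.2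

theorem cyc_succ (G : Fin M → α) (k : ℤ) : cyc (fun i => G (i + 1)) k = cyc G (k + 1) := by
  simp only [cyc]
  congr 1
  have hM : 0 < (M : ℤ) := by have := NeZero.pos M; omega
  have h₁ := Int.emod_nonneg k hM.ne'
  have h₂ := Int.emod_nonneg (k + 1) hM.ne'
  apply Fin.ext
  zify
  simp [Fin.val_add, Fin.ofNat, h₁, h₂]

theorem cyc_val_succ (G : Fin M → α) (i : Fin M) : cyc G ((i : ℕ) + 1) = G (i + 1) := by
  rw [← cyc_succ, cyc_val]

theorem sum_cyc (G : Fin M → ℝ) (a : ℤ) :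
    ∑ i, G i = ∑ j ∈ Finset.range M, cyc G (a + (j : ℕ)) := by
  have step : ∀ a : ℤ, ∑ j ∈ Finset.range M, cyc G (a + 1 + (j : ℕ)) =
      ∑ j ∈ Finset.range M, cyc G (a + (j : ℕ)) := by
    intro a
    have h₁ := Finset.sum_range_succ (fun j : ℕ => cyc G (a + (j : ℕ))) M
    have h₂ := Finset.sum_range_succ' (fun j : ℕ => cyc G (a + (j : ℕ))) M
    rw [h₁, cyc_add] at h₂
    simp only [Nat.cast_zero, add_zero, add_left_inj] at h₂
    rw [h₂]
    refine Finset.sum_congr rfl fun j _ => ?_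
    push_cast
    congr 1
    ring
  have base : ∑ i, G i = ∑ j ∈ Finset.range M, cyc G (0 + (j : ℕ)) := by
    rw [Finset.sum_range]
    exact Finset.sum_congr rfl fun i _ => by rw [zero_add, cyc_val]
  rw [base]
  induction a using Int.induction_on with
  | zero => rfl
  | succ k ih => rw [step, ih]
  | pred k ih => rw [ih, ← step (-k - 1), sub_add_cancel]

theorem IsConvexCCW.convexSeq {A : Fin M → ℝ × ℝ} (hA : IsConvexCCW A) :
    ConvexSeq M (cyc A) where
  periodic := cyc_add A
  pos a j h₁ h₂ := by
    have hM : 0 < (M : ℤ) := by omega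
    have e : ∀ x : ℤ, ∃ i : Fin M, ((i : ℕ) : ℤ) = x % M := fun x =>
      ⟨⟨(x % M).toNat, by have := Int.emod_lt_of_pos x hM; omega⟩, by
        have := Int.emod_nonneg x hM.ne'; simp [this]⟩
    obtain ⟨i, hi⟩ := e a
    obtain ⟨k, hk⟩ := e j
    have ea : cyc A a = A i := by
      rw [← cyc_val A i, hi]; simpa using (cyc_emod A a 0).symm
    have ea' : cyc A (a + 1) = A (i + 1) := by
      rw [← cyc_val_succ A i, hi, cyc_emod]
    have ej : cyc A j = A k := by
      rw [← cyc_val A k, hk]; simpa using (cyc_emod A j 0).symm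
    rw [ea, ea', ej]
    refine hA i k ?_ ?_
    · rintro rfl
      have : (j - a) % M = 0 := Int.emod_eq_zero_of_dvd
        (Int.ModEq.dvd (show a % M = j % M by omega))
      rw [Int.emod_eq_of_lt (by omega) (by omega)] at this
      omega
    · intro hki
      have : ((i + 1 : Fin M) : ℕ) = ((i : ℕ) + 1) % M := by simp [Fin.val_add]
      have h₃ : (((i + 1 : Fin M) : ℕ) : ℤ) = (a + 1) % M := by
        rw [this]; push_cast; rw [hi]; simp
      rw [← hki, hk] at h₃
      have : (j - (a + 1)) % M = 0 := Int.emod_eq_zero_of_dvd (Int.ModEq.dvd h₃.symm)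
      rw [Int.emod_eq_of_lt (by omega) (by omega)] at this
      omega

/-- Convexity may be tested on the edges of one period of the periodic extension. -/
theorem isConvexCCW_of_cyc {A : Fin M → ℝ × ℝ} (s : ℤ)
    (h : ∀ a j, s ≤ a → a < s + M → a + 1 < j → j < a + M →
      0 < wedge (cyc A (a + 1) - cyc A a) (cyc A j - cyc A a)) : IsConvexCCW A := by
  intro i k h₁ h₂
  have hM : 0 < (M : ℤ) := by have := NeZero.pos M; omega
  have rep : ∀ (x : ℕ) (t : ℤ), ∃ y, t ≤ y ∧ y < t + M ∧ y % M = (x : ℤ) % M := fun x t =>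
    ⟨t + (x - t) % M, by have := Int.emod_nonneg (x - t) hM.ne'; omega,
      by have := Int.emod_lt_of_pos (x - t) hM; omega, by simp⟩
  obtain ⟨a, ha, ha', hai⟩ := rep i s
  obtain ⟨j, hj, hj', hjk⟩ := rep k a
  have ea : cyc A a = A i := by
    rw [← cyc_val A i]; simp only [cyc, hai]
  have ea' : cyc A (a + 1) = A (i + 1) := by
    rw [← cyc_val_succ A i, ← cyc_emod, hai, cyc_emod]
  have ej : cyc A j = A k := by
    rw [← cyc_val A k]; simp only [cyc, hjk]
  have inj : ∀ x y : Fin M, ((x : ℕ) : ℤ) % M = ((y : ℕ) : ℤ) % M → x = y := by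
    intro x y hxy
    have := x.2
    have := y.2
    rw [Int.emod_eq_of_lt (by omega) (by omega), Int.emod_eq_of_lt (by omega) (by omega)] at hxy
    exact Fin.ext (by omega)
  rw [← ea, ← ea', ← ej]
  refine h a j ha ha' ?_ hj'
  have n₁ : j ≠ a := by
    rintro rfl
    exact h₁ (inj _ _ (hjk.symm.trans hai))
  have n₂ : j ≠ a + 1 := by
    rintro rfl
    refine h₂ (inj _ _ (hjk.symm.trans ?_))
    rw [Int.add_emod, hai]
    simp [Fin.val_add]
  omega

/-- The sum of the areas of the triangles cut off by the short diagonals. -/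
noncomputable def earSum (A : Fin M → ℝ × ℝ) : ℝ :=
  ∑ i : Fin M, triArea (A i) (A (i + 1)) (A (i + 1 + 1))

theorem polyArea_eq_sum_cyc (A : Fin M → ℝ × ℝ) (a : ℤ) :
    polyArea A = ∑ j ∈ Finset.range M, wedge (cyc A (a + (j : ℕ))) (cyc A (a + (j : ℕ) + 1)) := by
  rw [polyArea, sum_cyc _ a]
  refine Finset.sum_congr rfl fun j _ => ?_
  rw [← cyc_succ]
  rfl

theorem earSum_eq_sum_cyc (A : Fin M → ℝ × ℝ) (a : ℤ) :
    earSum A = ∑ j ∈ Finset.range M, triArea (cyc A (a + (j : ℕ))) (cyc A (a + (j : ℕ) + 1))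
      (cyc A (a + (j : ℕ) + 1 + 1)) := by
  rw [earSum, sum_cyc _ a]
  refine Finset.sum_congr rfl fun j _ => ?_
  rw [← cyc_succ, ← cyc_succ, ← cyc_succ]
  rfl

theorem sum_add_one (f : Fin M → ℝ) : ∑ i, f (i + 1) = ∑ i, f i := by
  rw [sum_cyc _ 0, sum_cyc f 1]
  refine Finset.sum_congr rfl fun j _ => ?_
  rw [cyc_succ]
  congr 1
  ring

theorem polyArea_kasner (m : ℝ) (A : Fin M → ℝ × ℝ) :
    polyArea (kasner m A) = polyArea A - m * (1 - m) * earSum A := by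
  have h := sum_add_one fun i => wedge (A i) (A (i + 1))
  have : polyArea (kasner m A) = ∑ i, ((1 - m) * wedge (A i) (A (i + 1)) +
      m * wedge (A (i + 1)) (A (i + 1 + 1)) -
      m * (1 - m) * triArea (A i) (A (i + 1)) (A (i + 1 + 1))) := by
    refine Finset.sum_congr rfl fun i _ => ?_
    simp only [kasner, triArea, wedge, Prod.fst_sub, Prod.snd_sub, Prod.fst_add, Prod.snd_add,
      Prod.smul_fst, Prod.smul_snd, smul_eq_mul]
    ring
  rw [this, Finset.sum_sub_distrib, Finset.sum_add_distrib, ← Finset.mul_sum, ← Finset.mul_sum,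
    ← Finset.mul_sum, h, polyArea, earSum]
  ring

theorem IsConvexCCW.polyArea_pos {A : Fin M → ℝ × ℝ} (hA : IsConvexCCW A) (hM : 3 ≤ M) :
    0 < polyArea A := by
  have h : polyArea A = ∑ i, wedge (A i - A 0) (A (i + 1) - A 0) := by
    have h := sum_add_one fun i => wedge (A i) (A 0)
    have : ∑ i, wedge (A i - A 0) (A (i + 1) - A 0) =
        ∑ i, (wedge (A i) (A (i + 1)) - wedge (A i) (A 0) + wedge (A (i + 1)) (A 0)) := by
      refine Finset.sum_congr rfl fun i _ => ?_
      simp only [wedge, Prod.fst_sub, Prod.snd_sub]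
      ring
    rw [this, Finset.sum_add_distrib, Finset.sum_sub_distrib, h, polyArea]
    ring
  have pos : ∀ i : Fin M, 0 ≠ i → 0 ≠ i + 1 → 0 < wedge (A i - A 0) (A (i + 1) - A 0) := by
    intro i h₁ h₂
    have := hA i 0 h₁ h₂
    simp only [wedge, Prod.fst_sub, Prod.snd_sub] at this ⊢
    linarith
  rw [h]
  refine Finset.sum_pos' (fun i _ => ?_) ⟨1, Finset.mem_univ _, ?_⟩
  · by_cases h₁ : 0 = i
    · rw [← h₁]; simp [wedge]
    by_cases h₂ : 0 = i + 1
    · rw [← h₂]; simp [wedge]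
    exact (pos i h₁ h₂).le
  · refine pos _ (fun h => ?_) (fun h => ?_)
    · have := congrArg Fin.val h
      rw [Fin.val_one', Nat.mod_eq_of_lt (by omega : 1 < M)] at this
      simp at this
    · have := congrArg Fin.val h
      rw [Fin.val_add, Fin.val_one', Nat.mod_eq_of_lt (by omega : 1 < M),
        Nat.mod_eq_of_lt (by omega)] at this
      simp at this

theorem IsConvexCCW.earSum_nonneg {A : Fin M → ℝ × ℝ} (hA : IsConvexCCW A) (hM : 3 ≤ M) :
    0 ≤ earSum A := by
  rw [earSum_eq_sum_cyc A 0]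
  exact Finset.sum_nonneg fun j _ =>
    (hA.convexSeq.pos _ _ (by omega) (by omega)).le

end Cyclic

section Removal

variable {n : ℕ} [NeZero n] {α : Type*} (A : Fin (n + 1) → α) (i : Fin (n + 1))

theorem cyc_removal {x : ℤ} (h₁ : (i : ℕ) ≤ x) (h₂ : x < (i : ℕ) + n) :
    cyc (A ∘ i.succAbove) x = cyc A (x + 1) := by
  have hi := i.2
  rcases lt_or_ge x n with h | h
  · lift x to ℕ using by omega
    have hx : x < n := by omega
    rw [cyc_of_lt _ hx, show (x : ℤ) + 1 = ((x + 1 : ℕ) : ℤ) by push_cast; rfl,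
      cyc_of_lt A (by omega : x + 1 < n + 1)]
    simp only [Function.comp]
    rw [Fin.succAbove_of_le_castSucc _ _ (by simp [Fin.le_def]; omega)]
    rfl
  · obtain ⟨y, rfl⟩ : ∃ y, x = y + n := ⟨x - n, by ring⟩
    lift y to ℕ using by omega
    have hy : y < n := by omega
    rw [cyc_add, cyc_of_lt _ hy,
      show (y : ℤ) + n + 1 = (y : ℤ) + ((n + 1 : ℕ) : ℤ) by push_cast; ring,
      cyc_add, cyc_of_lt A (by omega : y < n + 1)]
    simp only [Function.comp]
    rw [Fin.succAbove_of_castSucc_lt _ _ (by simp [Fin.lt_def]; omega)]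
    rfl

theorem cyc_removal' {x : ℤ} (h₁ : (i : ℕ) + n ≤ x) (h₂ : x < (i : ℕ) + n + n) :
    cyc (A ∘ i.succAbove) x = cyc A (x + 2) := by
  obtain ⟨y, rfl⟩ : ∃ y, x = y + n := ⟨x - n, by ring⟩
  rw [cyc_add, cyc_removal A i (by omega) (by omega), ← cyc_add]
  congr 1
  push_cast
  ring

end Removal

section Ratio

variable {n : ℕ} [NeZero n] {A : Fin (n + 1) → ℝ × ℝ}

theorem IsConvexCCW.removal (hA : IsConvexCCW A) (i : Fin (n + 1)) :
    IsConvexCCW (A ∘ i.succAbove) := by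
  refine isConvexCCW_of_cyc (i : ℕ) fun a j h₁ h₂ h₃ h₄ => ?_
  have H := fun {a b c : ℤ} => hA.convexSeq.tri_pos (a := a) (b := b) (c := c)
  push_cast at H
  rw [cyc_removal A i h₁ h₂]
  rcases lt_or_ge (a + 1) ((i : ℕ) + n) with h | h
  · rw [cyc_removal A i (by omega) h]
    rcases lt_or_ge j ((i : ℕ) + n) with h' | h'
    · rw [cyc_removal A i (by omega) h']
      exact H (by omega) (by omega) (by omega)
    · rw [cyc_removal' A i h' (by omega)]
      exact H (by omega) (by omega) (by omega)
  · rw [cyc_removal' A i h (by omega), cyc_removal' A i (by omega) (by omega)]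
    exact H (by omega) (by omega) (by omega)

theorem polyArea_removal (hn : 2 ≤ n) (A : Fin (n + 1) → ℝ × ℝ) (i : Fin (n + 1)) :
    polyArea (A ∘ i.succAbove) = polyArea A -
      wedge (edge (cyc A) ((i : ℕ) - 1)) (edge (cyc A) (i : ℕ)) := by
  obtain ⟨p, rfl⟩ : ∃ p, n = p + 1 := ⟨n - 1, by omega⟩
  have per := cyc_add A
  push_cast at per
  rw [polyArea_eq_sum_cyc _ (i : ℕ), polyArea_eq_sum_cyc A ((i : ℕ) + 1),
    Finset.sum_range_succ, Finset.sum_range_succ, Finset.sum_range_succ]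
  have : ∑ j ∈ Finset.range p, wedge (cyc (A ∘ i.succAbove) ((i : ℕ) + (j : ℕ)))
      (cyc (A ∘ i.succAbove) ((i : ℕ) + (j : ℕ) + 1)) =
      ∑ j ∈ Finset.range p, wedge (cyc A ((i : ℕ) + 1 + (j : ℕ)))
      (cyc A ((i : ℕ) + 1 + (j : ℕ) + 1)) := by
    refine Finset.sum_congr rfl fun j hj => ?_
    have := Finset.mem_range.1 hj
    rw [cyc_removal A i (by omega) (by push_cast; omega),
      cyc_removal A i (by omega) (by push_cast; omega)]
    ring_nf
  rw [this, cyc_removal A i (by omega) (by push_cast; omega),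
    cyc_removal' A i (by push_cast; omega) (by push_cast; omega)]
  have e₀ := per ((i : ℕ) - 1)
  have e₁ := per (i : ℕ)
  have e₂ := per ((i : ℕ) + 1)
  simp only [edge]
  push_cast
  ring_nf at e₀ e₁ e₂ ⊢
  rw [e₀, e₁, e₂]
  simp only [wedge, Prod.fst_sub, Prod.snd_sub, Prod.fst_add, Prod.snd_add, Prod.fst_neg,
    Prod.snd_neg]
  ring

theorem earSum_removal (hn : 2 ≤ n) (A : Fin (n + 1) → ℝ × ℝ) (i : Fin (n + 1)) :
    earSum (A ∘ i.succAbove) = earSum A -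
      (wedge (edge (cyc A) ((i : ℕ) - 1)) (edge (cyc A) (i : ℕ)) -
        wedge (edge (cyc A) ((i : ℕ) - 2)) (edge (cyc A) (i : ℕ)) -
        wedge (edge (cyc A) ((i : ℕ) - 1)) (edge (cyc A) ((i : ℕ) + 1))) := by
  obtain ⟨p, rfl⟩ : ∃ p, n = p + 2 := ⟨n - 2, by omega⟩
  have per := cyc_add A
  push_cast at per
  rw [earSum_eq_sum_cyc _ (i : ℕ), earSum_eq_sum_cyc A ((i : ℕ) + 1),
    Finset.sum_range_succ, Finset.sum_range_succ, Finset.sum_range_succ, Finset.sum_range_succ,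
    Finset.sum_range_succ]
  have : ∑ j ∈ Finset.range p, triArea (cyc (A ∘ i.succAbove) ((i : ℕ) + (j : ℕ)))
      (cyc (A ∘ i.succAbove) ((i : ℕ) + (j : ℕ) + 1))
      (cyc (A ∘ i.succAbove) ((i : ℕ) + (j : ℕ) + 1 + 1)) =
      ∑ j ∈ Finset.range p, triArea (cyc A ((i : ℕ) + 1 + (j : ℕ)))
      (cyc A ((i : ℕ) + 1 + (j : ℕ) + 1)) (cyc A ((i : ℕ) + 1 + (j : ℕ) + 1 + 1)) := by
    refine Finset.sum_congr rfl fun j hj => ?_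
    have := Finset.mem_range.1 hj
    rw [cyc_removal A i (by omega) (by push_cast; omega),
      cyc_removal A i (by omega) (by push_cast; omega),
      cyc_removal A i (by omega) (by push_cast; omega)]
    ring_nf
  rw [this, cyc_removal A i (x := (i : ℕ) + (p : ℕ)) (by omega) (by push_cast; omega),
    cyc_removal A i (x := (i : ℕ) + (p : ℕ) + 1) (by omega) (by push_cast; omega),
    cyc_removal' A i (x := (i : ℕ) + (p : ℕ) + 1 + 1) (by push_cast; omega) (by push_cast; omega),
    cyc_removal A i (x := (i : ℕ) + ((p + 1 : ℕ) : ℤ)) (by omega) (by push_cast; omega),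
    cyc_removal' A i (x := (i : ℕ) + ((p + 1 : ℕ) : ℤ) + 1) (by push_cast; omega)
      (by push_cast; omega),
    cyc_removal' A i (x := (i : ℕ) + ((p + 1 : ℕ) : ℤ) + 1 + 1) (by push_cast; omega)
      (by push_cast; omega)]
  have e₀ := per ((i : ℕ) - 2)
  have e₁ := per ((i : ℕ) - 1)
  have e₂ := per (i : ℕ)
  have e₃ := per ((i : ℕ) + 1)
  have e₄ := per ((i : ℕ) + 2)
  simp only [edge]
  push_cast
  ring_nf at e₀ e₁ e₂ e₃ e₄ ⊢
  rw [e₀, e₁, e₂, e₃, e₄]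
  simp only [triArea, wedge, Prod.fst_sub, Prod.snd_sub, Prod.fst_add, Prod.snd_add, Prod.fst_neg,
    Prod.snd_neg]
  ring

end Ratio

theorem remove_vertex_ratio (n : ℕ) [NeZero n] (hn : 6 ≤ n)
    (m : ℝ) (hm : m ∈ Set.Ioo (0:ℝ) 1)
    (A : Fin (n + 1) → ℝ × ℝ) (hA : IsConvexCCW A) :
    ∃ i : Fin (n + 1), IsConvexCCW (A ∘ i.succAbove) ∧
      polyArea (kasner m (A ∘ i.succAbove)) / polyArea (A ∘ i.succAbove) ≤
        polyArea (kasner m A) / polyArea A := by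
  have hB := hA.convexSeq
  obtain ⟨k, hk⟩ := hB.exists_wedge_edge_le (by push_cast; omega)
  have h₀ := Int.emod_nonneg k (by omega : ((n + 1 : ℕ) : ℤ) ≠ 0)
  have h₁ := Int.emod_lt_of_pos k (by omega : 0 < ((n + 1 : ℕ) : ℤ))
  obtain ⟨i, hi⟩ : ∃ i : Fin (n + 1), ((i : ℕ) : ℤ) = k % ((n + 1 : ℕ) : ℤ) :=
    ⟨⟨(k % ((n + 1 : ℕ) : ℤ)).toNat, by omega⟩, by simp only; omega⟩
  have shift : ∀ c : ℤ, edge (cyc A) ((i : ℕ) + c) = edge (cyc A) (k + c) := by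
    intro c
    simp only [edge, add_assoc, hi, cyc_emod]
  have s₀ := shift 0
  simp only [add_zero] at s₀
  simp only [sub_eq_add_neg, ← shift, ← s₀] at hk
  simp only [← sub_eq_add_neg] at hk
  have hL := hA.removal i
  refine ⟨i, hL, ?_⟩
  have pL := hL.polyArea_pos (by omega)
  have pA := hA.polyArea_pos (by omega)
  have eA := hA.earSum_nonneg (by omega)
  have aL := polyArea_removal (by omega) A i
  have tL := earSum_removal (by omega) A i
  have ti := hB.wedge_edge_succ_pos (by push_cast; omega) ((i : ℕ) - 1)
  rw [sub_add_cancel] at ti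
  rw [polyArea_kasner, polyArea_kasner, div_le_div_iff₀ pL pA]
  have hc : 0 ≤ m * (1 - m) := mul_nonneg hm.1.le (by linarith [hm.2])
  have key : earSum A * polyArea (A ∘ i.succAbove) ≤ earSum (A ∘ i.succAbove) * polyArea A :=
    mul_le_mul (by linarith) (by linarith) pL.le (by linarith)
  have := mul_le_mul_of_nonneg_left key hc
  linarith
end
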